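/- Let $M_{k,n}$ be the number of vertices with at least $k$ descendants in a uniform random recursive tree on $n$ vertices. Assuming the upper-tail bound $\mathbb{P}\{L_{i,n} \ge \mathbb{E} L_{i,n} + s\} \le \exp(-8 s^2 (i+2)/(25(n + (i+1)(i+2)s/3)))$ for each $i$, one has $\mathbb{P}\{M_{k,n} \le \frac{n+1}{k+1} - 1 - t\} \le k \exp\big(\frac{-8t^2}{25k(n + (k+1)t/3)}\big)$, and in particular $\mathbb{P}\{M_{k,n} \le n/(3k)\} \le k \exp(-\frac{1}{32}\frac{n}{k^2})$. -/

import Mathlib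

open MeasureTheory
open scoped Classical

/-- The parent map of a recursive tree on vertices `0,1,…` encoded by attachment choices
`a`: vertex `w` (for `1 ≤ w ≤ m`) is attached to the earlier vertex `a ⟨w-1⟩ ∈ {0,…,w-1}`;
the root `0` is mapped to itself. -/
def parentFun (m : ℕ) (a : ∀ i : Fin m, Fin ((i : ℕ) + 1)) : ℕ → ℕ := fun w =>
  if h : w - 1 < m then (a ⟨w - 1, h⟩ : ℕ) else 0

/-- Number of (strict) descendants of `v` in the tree on vertex set `{0,…,n-1}` with parent
map `par`. -/
noncomputable def descCount (n : ℕ) (par : ℕ → ℕ) (v : ℕ) : ℕ :=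
  ((Finset.range n).filter fun w => w ≠ v ∧ ∃ j ∈ Finset.range n, par^[j] w = v).card

/-- The number `L_{k,n}` of vertices with exactly `k` descendants. -/
noncomputable def numDescEq (n k : ℕ) (par : ℕ → ℕ) : ℕ :=
  ((Finset.range n).filter fun v => descCount n par v = k).card

/-- The number `M_{k,n}` of vertices with at least `k` descendants. -/
noncomputable def numDescGe (n k : ℕ) (par : ℕ → ℕ) : ℕ :=
  ((Finset.range n).filter fun v => k ≤ descCount n par v).card

/-- The uniform random recursive tree on `n` vertices, encoded by its uniform attachment
vector. -/
noncomputable def urrt (n : ℕ) : Measure (∀ i : Fin (n - 1), Fin ((i : ℕ) + 1)) :=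
  (PMF.uniformOfFintype _).toMeasure

/-- Unlabelled binary trees, encoding rooted forests by the left-child right-sibling
correspondence: `node l r` is a forest whose first tree has `l` as the forest of subtrees below
its root, followed by the forest `r`. -/
inductive BinShape
  | nil : BinShape
  | node : BinShape → BinShape → BinShape

namespace BinShape

/-- The number of nodes. -/
def size : BinShape → ℕ
  | nil => 0
  | node l r => l.size + r.size + 1

/-- The sum of `F` over all trees obtained from `t` by adding a node at one of the external
positions of `t`. -/
def growSum : BinShape → (BinShape → ℝ) → ℝ
  | nil, F => F (node nil nil)
  | node l r, F => l.growSum (fun l' => F (node l' r)) + r.growSum (fun r' => F (node l r'))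

/-- `growSum` as an operator on functionals of trees. -/
def grow (F : BinShape → ℝ) (t : BinShape) : ℝ := t.growSum F

/-- The product over all nodes of `g` evaluated at the size of the left subtree. -/
def leftWeight (g : ℕ → ℝ) : BinShape → ℝ
  | nil => 1
  | node l r => g l.size * l.leftWeight g * r.leftWeight g

/-- The number of nodes whose left subtree has at least `k` nodes. -/
def countLeft (k : ℕ) : BinShape → ℕ
  | nil => 0
  | node l r => (if k ≤ l.size then 1 else 0) + l.countLeft k + r.countLeft k

lemma growSum_const_mul (t : BinShape) (c : ℝ) (F : BinShape → ℝ) :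
    t.growSum (fun t' => c * F t') = c * t.growSum F := by
  induction t generalizing F with
  | nil => rfl
  | node l r ihl ihr => simp only [growSum, ihl, ihr, mul_add]

lemma growSum_sum {ι : Type*} (t : BinShape) (s : Finset ι) (F : ι → BinShape → ℝ) :
    t.growSum (fun t' => ∑ i ∈ s, F i t') = ∑ i ∈ s, t.growSum (F i) := by
  induction t generalizing F with
  | nil => rfl
  | node l r ihl ihr => simp only [growSum, ihl, ihr, Finset.sum_add_distrib]

lemma growSum_size_mul (t : BinShape) (h : ℕ → ℝ) (F : BinShape → ℝ) :
    t.growSum (fun t' => h t'.size * F t') = h (t.size + 1) * t.growSum F := by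
  induction t generalizing h F with
  | nil => rfl
  | node l r ihl ihr =>
    simp only [growSum, size]
    rw [ihl (fun j => h (j + r.size + 1)), ihr (fun j => h (l.size + j + 1)), mul_add]
    congr 3
    ring

lemma grow_iterate_size_mul (m : ℕ) (t : BinShape) (h : ℕ → ℝ) (F : BinShape → ℝ) :
    (grow^[m] fun t' => h t'.size * F t') t = h (t.size + m) * (grow^[m] F) t := by
  induction m generalizing t with
  | zero => rfl
  | succ m ih =>
    rw [Function.iterate_succ_apply', Function.iterate_succ_apply']
    have : (grow^[m] fun t' => h t'.size * F t') =
        fun t => h (t.size + m) * (grow^[m] F) t := funext ih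
    rw [this, grow, growSum_size_mul t (fun j => h (j + m)), grow]
    congr 2
    ring

/-- Leibniz rule for the growth operator. -/
lemma grow_iterate_node (F φ ψ : BinShape → ℝ) (hF : ∀ l r, F (node l r) = φ l * ψ r) (m : ℕ)
    (l r : BinShape) :
    (grow^[m] F) (node l r) = ∑ ij ∈ Finset.HasAntidiagonal.antidiagonal m,
      (m.choose ij.1 : ℝ) * ((grow^[ij.1] φ) l * (grow^[ij.2] ψ) r) := by
  induction m generalizing l r with
  | zero => simp [hF]
  | succ m ih =>
    rw [Finset.sum_antidiagonal_choose_succ_mul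
      (fun i j => (grow^[i] φ) l * (grow^[j] ψ) r), Function.iterate_succ_apply', grow, growSum]
    simp only [ih, growSum_sum, growSum_const_mul]
    rw [add_comm]
    congr 1
    · refine Finset.sum_congr rfl fun ij _ => ?_
      rw [Function.iterate_succ_apply', grow]
    · refine Finset.sum_congr rfl fun ij hij => ?_
      rw [Function.iterate_succ_apply', grow, Nat.choose_symm_of_eq_add
        (Finset.HasAntidiagonal.mem_antidiagonal.1 hij).symm]
      simp only [mul_comm _ ((grow^[ij.2] ψ) r), growSum_const_mul]

lemma grow_iterate_leftWeight_succ (g : ℕ → ℝ) (m : ℕ) :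
    (grow^[m + 1] (leftWeight g)) nil = ∑ ij ∈ Finset.HasAntidiagonal.antidiagonal m, (m.choose ij.1 : ℝ) *
      (g ij.1 * (grow^[ij.1] (leftWeight g)) nil * (grow^[ij.2] (leftWeight g)) nil) := by
  rw [Function.iterate_succ_apply', grow, growSum,
    grow_iterate_node (leftWeight g) (fun l => g l.size * leftWeight g l) (leftWeight g)
      (fun _ _ => rfl)]
  simp only [grow_iterate_size_mul, size, zero_add]

lemma leftWeight_ite (k : ℕ) (x : ℝ) (t : BinShape) :
    leftWeight (fun i => if k ≤ i then x else 1) t = x ^ t.countLeft k := by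
  induction t with
  | nil => simp [leftWeight, countLeft]
  | node l r ihl ihr =>
    rw [leftWeight, countLeft, ihl, ihr, pow_add, pow_add]
    split_ifs <;> simp

end BinShape

/-- Binary trees with nodes labelled by natural numbers. Together with a label for a virtual root,
such a tree encodes a rooted tree by the left-child right-sibling correspondence. -/
inductive LabTree
  | nil : LabTree
  | node : ℕ → LabTree → LabTree → LabTree

namespace LabTree

/-- Forget the labels. -/
def shape : LabTree → BinShape
  | nil => .nil
  | node _ l r => .node l.shape r.shape

/-- The vertices of the rooted tree encoded by `t` with virtual root `ρ`. -/
def vertices (ρ : ℕ) : LabTree → Finset ℕ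
  | nil => {ρ}
  | node a l r => l.vertices a ∪ r.vertices ρ

/-- The vertices are pairwise distinct. -/
def Distinct (ρ : ℕ) : LabTree → Prop
  | nil => True
  | node a l r => l.Distinct a ∧ r.Distinct ρ ∧ Disjoint (l.vertices a) (r.vertices ρ)

/-- Attach the new vertex `w` to the vertex `v`, as last child. -/
def attach (v w : ℕ) (ρ : ℕ) : LabTree → LabTree
  | nil => if v = ρ then node w nil nil else nil
  | node a l r => node a (l.attach v w a) (r.attach v w ρ)

/-- The vertices below `u` in the encoded rooted tree, including `u`. -/
def subtree (u : ℕ) (ρ : ℕ) : LabTree → Finset ℕ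
  | nil => if u = ρ then {ρ} else ∅
  | node a l r => if u = ρ then l.vertices a ∪ r.vertices ρ else l.subtree u a ∪ r.subtree u ρ

lemma root_mem_vertices (ρ : ℕ) (t : LabTree) : ρ ∈ t.vertices ρ := by
  induction t with
  | nil => simp [vertices]
  | node a l r _ ihr => simp [vertices, ihr]

lemma subtree_root (ρ : ℕ) (t : LabTree) : t.subtree ρ ρ = t.vertices ρ := by
  cases t <;> simp [subtree, vertices]

lemma attach_of_notMem {v w ρ : ℕ} {t : LabTree} (h : v ∉ t.vertices ρ) :
    t.attach v w ρ = t := by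
  induction t generalizing ρ with
  | nil => simp_all [vertices, attach]
  | node a l r ihl ihr =>
    simp only [vertices, Finset.mem_union, not_or] at h
    rw [attach, ihl h.1, ihr h.2]

lemma mem_vertices_attach {v w ρ x : ℕ} {t : LabTree} :
    x ∈ (t.attach v w ρ).vertices ρ ↔ x ∈ t.vertices ρ ∨ x = w ∧ v ∈ t.vertices ρ := by
  induction t generalizing ρ with
  | nil =>
    by_cases h : v = ρ <;> simp [vertices, attach, h, or_comm]
  | node a l r ihl ihr =>
    simp only [attach, vertices, Finset.mem_union, ihl, ihr]
    tauto

lemma Distinct.attach {v w ρ : ℕ} {t : LabTree} (h : t.Distinct ρ) (hw : w ∉ t.vertices ρ) :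
    (t.attach v w ρ).Distinct ρ := by
  induction t generalizing ρ with
  | nil =>
    by_cases hv : v = ρ
    · simpa [LabTree.attach, hv, Distinct, vertices] using hw
    · simp [LabTree.attach, hv, Distinct]
  | node a l r ihl ihr =>
    obtain ⟨hl, hr, hd⟩ := h
    simp only [vertices, Finset.mem_union, not_or] at hw
    refine ⟨ihl hl hw.1, ihr hr hw.2, ?_⟩
    rw [Finset.disjoint_left] at hd ⊢
    intro x
    simp only [mem_vertices_attach]
    have h1 := @hd x
    have h2 := @hd v
    rintro (h | ⟨rfl, h⟩) (h' | ⟨h', h''⟩)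
    · exact h1 h h'
    · exact hw.1 (h' ▸ h)
    · exact hw.2 h'
    · exact h2 h h''

lemma mem_subtree_attach {v w ρ x u : ℕ} {t : LabTree} (hu : u ≠ w) :
    x ∈ (t.attach v w ρ).subtree u ρ ↔
      x ∈ t.subtree u ρ ∨ x = w ∧ v ∈ t.subtree u ρ := by
  induction t generalizing ρ with
  | nil =>
    by_cases h : v = ρ <;> by_cases h' : u = ρ <;>
      simp [vertices, LabTree.attach, subtree, h, h', hu, or_comm]
  | node a l r ihl ihr =>
    by_cases h' : u = ρ
    · simp only [LabTree.attach, subtree, h', if_true, Finset.mem_union, mem_vertices_attach]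
      tauto
    · simp only [LabTree.attach, subtree, h', if_false, Finset.mem_union, ihl, ihr]
      tauto

lemma subtree_of_notMem {u ρ : ℕ} {t : LabTree} (h : u ∉ t.vertices ρ) :
    t.subtree u ρ = ∅ := by
  induction t generalizing ρ with
  | nil => simp_all [vertices, subtree]
  | node a l r ihl ihr =>
    have hρ : u ≠ ρ := fun e => h (e ▸ root_mem_vertices _ _)
    simp only [vertices, Finset.mem_union, not_or] at h
    simp [subtree, hρ, ihl h.1, ihr h.2]

lemma subtree_attach_self {v w ρ : ℕ} {t : LabTree} (hw : w ∉ t.vertices ρ)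
    (hv : v ∈ t.vertices ρ) : (t.attach v w ρ).subtree w ρ = {w} := by
  have key : ∀ (ρ : ℕ) (t : LabTree), w ∉ t.vertices ρ →
      (t.attach v w ρ).subtree w ρ = if v ∈ t.vertices ρ then {w} else ∅ := by
    intro ρ t
    induction t generalizing ρ with
    | nil =>
      intro hw
      have : w ≠ ρ := by simpa [vertices] using hw
      by_cases h : v = ρ <;> simp [vertices, LabTree.attach, subtree, h, this]
    | node a l r ihl ihr =>
      intro hw
      have hρ : w ≠ ρ := fun e => hw (e ▸ root_mem_vertices _ _)
      simp only [vertices, Finset.mem_union, not_or] at hw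
      simp only [LabTree.attach, subtree, hρ, if_false, ihl _ hw.1, ihr _ hw.2, vertices,
        Finset.mem_union]
      by_cases h1 : v ∈ l.vertices a <;> by_cases h2 : v ∈ r.vertices ρ <;> simp [h1, h2]
  rw [key ρ t hw, if_pos hv]

lemma Distinct.card_vertices {ρ : ℕ} {t : LabTree} (h : t.Distinct ρ) :
    (t.vertices ρ).card = t.shape.size + 1 := by
  induction t generalizing ρ with
  | nil => simp [vertices, shape, BinShape.size]
  | node a l r ihl ihr =>
    rw [vertices, Finset.card_union_of_disjoint h.2.2, ihl h.1, ihr h.2.1, shape, BinShape.size]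
    ring

lemma Distinct.sum_attach {ρ w : ℕ} {t : LabTree} (h : t.Distinct ρ) (F : BinShape → ℝ) :
    ∑ v ∈ t.vertices ρ, F (t.attach v w ρ).shape = t.shape.growSum F := by
  induction t generalizing ρ F with
  | nil => simp [vertices, LabTree.attach, shape, BinShape.growSum]
  | node a l r ihl ihr =>
    obtain ⟨hl, hr, hd⟩ := h
    rw [vertices, Finset.sum_union hd, shape, BinShape.growSum, ← ihl hl, ← ihr hr]
    congr 1
    · refine Finset.sum_congr rfl fun v hv => ?_
      rw [LabTree.attach, attach_of_notMem (Finset.disjoint_left.1 hd hv), shape]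
    · refine Finset.sum_congr rfl fun v hv => ?_
      rw [LabTree.attach, attach_of_notMem (Finset.disjoint_right.1 hd hv), shape]

lemma Distinct.sum_erase_root {ρ : ℕ} {t : LabTree} (h : t.Distinct ρ) (k : ℕ) :
    (∑ u ∈ (t.vertices ρ).erase ρ, if k + 1 ≤ (t.subtree u ρ).card then 1 else 0) =
      t.shape.countLeft k := by
  induction t generalizing ρ with
  | nil => simp [vertices, shape, BinShape.countLeft]
  | node a l r ihl ihr =>
    obtain ⟨hl, hr, hd⟩ := h
    have hρ : ρ ∉ l.vertices a := Finset.disjoint_right.1 hd (root_mem_vertices _ _)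
    have hd' : Disjoint (l.vertices a) ((r.vertices ρ).erase ρ) :=
      hd.mono_right (Finset.erase_subset _ _)
    rw [vertices, Finset.erase_union_distrib, Finset.erase_eq_of_notMem hρ,
      Finset.sum_union hd', shape, BinShape.countLeft, ← ihl hl, ← ihr hr]
    congr 1
    · rw [← Finset.add_sum_erase _ _ (root_mem_vertices a l)]
      have aux : ∀ u ∈ l.vertices a, (node a l r).subtree u ρ = l.subtree u a := by
        intro u hu
        have : u ≠ ρ := fun e => hρ (e ▸ hu)
        simp [subtree, this, subtree_of_notMem (Finset.disjoint_left.1 hd hu)]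
      congr 1
      · rw [aux a (root_mem_vertices _ _), subtree_root, hl.card_vertices]
        simp
      · refine Finset.sum_congr rfl fun u hu => ?_
        rw [aux u (Finset.mem_of_mem_erase hu)]
    · refine Finset.sum_congr rfl fun u hu => ?_
      have h1 := Finset.ne_of_mem_erase hu
      have h2 := Finset.disjoint_right.1 hd (Finset.mem_of_mem_erase hu)
      simp [subtree, h1, subtree_of_notMem h2]

lemma Distinct.card_filter_subtree {ρ : ℕ} {t : LabTree} (h : t.Distinct ρ) (k : ℕ) :
    ((t.vertices ρ).filter fun u => k + 1 ≤ (t.subtree u ρ).card).card =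
      (if k ≤ t.shape.size then 1 else 0) + t.shape.countLeft k := by
  rw [Finset.card_filter, ← Finset.add_sum_erase _ _ (root_mem_vertices ρ t), h.sum_erase_root,
    subtree_root, h.card_vertices]
  simp

/-- The encoding of the recursive tree on `{0, …, m}` with parent map `par`, virtual root `0`. -/
def ofParent (par : ℕ → ℕ) : ℕ → LabTree
  | 0 => nil
  | m + 1 => (ofParent par m).attach (par (m + 1)) (m + 1) 0

lemma ofParent_congr {p q : ℕ → ℕ} {m : ℕ} (h : ∀ w, 1 ≤ w → w ≤ m → p w = q w) :
    ofParent p m = ofParent q m := by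
  induction m with
  | zero => rfl
  | succ m ih =>
    rw [ofParent, ofParent, ih fun w h1 h2 => h w h1 (by omega), h (m + 1) (by omega) le_rfl]

lemma vertices_ofParent {par : ℕ → ℕ} {m : ℕ} (h : ∀ w, 1 ≤ w → w ≤ m → par w < w) :
    (ofParent par m).vertices 0 = Finset.range (m + 1) := by
  induction m with
  | zero => rfl
  | succ m ih =>
    ext x
    have := h (m + 1) (by omega) le_rfl
    rw [ofParent, mem_vertices_attach, ih fun w h1 h2 => h w h1 (by omega)]
    simp only [Finset.mem_range]
    omega

lemma distinct_ofParent {par : ℕ → ℕ} {m : ℕ} (h : ∀ w, 1 ≤ w → w ≤ m → par w < w) :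
    (ofParent par m).Distinct 0 := by
  induction m with
  | zero => trivial
  | succ m ih =>
    have h' : ∀ w, 1 ≤ w → w ≤ m → par w < w := fun w h1 h2 => h w h1 (by omega)
    refine (ih h').attach ?_
    simp [vertices_ofParent h']

lemma size_shape_ofParent {par : ℕ → ℕ} {m : ℕ} (h : ∀ w, 1 ≤ w → w ≤ m → par w < w) :
    (ofParent par m).shape.size = m := by
  have := (distinct_ofParent h).card_vertices
  rw [vertices_ofParent h, Finset.card_range] at this
  omega

lemma iterate_le {par : ℕ → ℕ} {m : ℕ} (h0 : par 0 = 0)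
    (h : ∀ w, 1 ≤ w → w ≤ m → par w < w) {x : ℕ} (hx : x ≤ m) (j : ℕ) :
    par^[j] x ≤ x - j := by
  induction j generalizing x with
  | zero => simp
  | succ j ih =>
    rw [Function.iterate_succ_apply]
    rcases Nat.eq_zero_or_pos x with rfl | hpos
    · have := ih (x := par 0) (by omega)
      omega
    · have h1 := h x hpos hx
      have := ih (x := par x) (by omega)
      omega

lemma mem_subtree_ofParent {par : ℕ → ℕ} {m : ℕ} (h0 : par 0 = 0)
    (h : ∀ w, 1 ≤ w → w ≤ m → par w < w) {u x : ℕ} (hu : u ≤ m) :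
    x ∈ (ofParent par m).subtree u 0 ↔ x ≤ m ∧ ∃ j, par^[j] x = u := by
  induction m generalizing u x with
  | zero =>
    obtain rfl : u = 0 := by omega
    simp only [ofParent, subtree, if_true, Finset.mem_singleton, Nat.le_zero]
    exact ⟨fun hx => ⟨hx, 0, hx⟩, fun hx => hx.1⟩
  | succ m ih =>
    have h' : ∀ w, 1 ≤ w → w ≤ m → par w < w := fun w h1 h2 => h w h1 (by omega)
    have hp : par (m + 1) ≤ m := Nat.lt_succ_iff.1 (h (m + 1) (by omega) le_rfl)
    rw [ofParent]
    rcases hu.eq_or_lt with rfl | hlt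
    · rw [subtree_attach_self (by simp [vertices_ofParent h'])
        (by simpa [vertices_ofParent h', Nat.lt_succ_iff] using hp), Finset.mem_singleton]
      constructor
      · rintro rfl
        exact ⟨le_rfl, 0, rfl⟩
      · rintro ⟨hx, j, hj⟩
        have := iterate_le h0 h hx j
        omega
    · rw [mem_subtree_attach hlt.ne, ih h' (by omega), ih h' (by omega)]
      constructor
      · rintro (⟨hx, hj⟩ | ⟨rfl, -, j, hj⟩)
        · exact ⟨by omega, hj⟩
        · exact ⟨le_rfl, j + 1, by rwa [Function.iterate_succ_apply]⟩
      · rintro ⟨hx, j, hj⟩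
        rcases hx.eq_or_lt with rfl | hx
        · refine Or.inr ⟨rfl, hp, ?_⟩
          cases j with
          | zero => exact absurd hj hlt.ne'
          | succ j => exact ⟨j, by rwa [Function.iterate_succ_apply] at hj⟩
        · exact Or.inl ⟨by omega, j, hj⟩

end LabTree

lemma descCount_add_one {par : ℕ → ℕ} {m u : ℕ} (h0 : par 0 = 0)
    (h : ∀ w, 1 ≤ w → w ≤ m → par w < w) (hu : u ≤ m) :
    descCount (m + 1) par u + 1 = ((LabTree.ofParent par m).subtree u 0).card := by
  have hmem : u ∈ (LabTree.ofParent par m).subtree u 0 :=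
    (LabTree.mem_subtree_ofParent h0 h hu).2 ⟨hu, 0, rfl⟩
  rw [← Finset.card_erase_add_one hmem, descCount]
  congr 2
  ext x
  simp only [Finset.mem_filter, Finset.mem_range, Finset.mem_erase,
    LabTree.mem_subtree_ofParent h0 h hu]
  constructor
  · rintro ⟨hx, hxu, j, -, hj⟩
    exact ⟨hxu, by omega, j, hj⟩
  · rintro ⟨hxu, hx, j, hj⟩
    refine ⟨by omega, hxu, ?_⟩
    rcases le_or_gt j m with hjm | hjm
    · exact ⟨j, by omega, hj⟩
    · have h1 := LabTree.iterate_le h0 h hx j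
      have h2 := LabTree.iterate_le h0 h hx m
      exact ⟨m, by omega, by omega⟩

lemma numDescGe_eq {par : ℕ → ℕ} {m : ℕ} (h0 : par 0 = 0)
    (h : ∀ w, 1 ≤ w → w ≤ m → par w < w) {k : ℕ} (hk : k ≤ m) :
    numDescGe (m + 1) k par = 1 + (LabTree.ofParent par m).shape.countLeft k := by
  have := (LabTree.distinct_ofParent h).card_filter_subtree k
  rw [LabTree.size_shape_ofParent h, if_pos hk, LabTree.vertices_ofParent h] at this
  rw [← this, numDescGe]
  congr 1
  refine Finset.filter_congr fun u hu => ?_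
  rw [← descCount_add_one h0 h (Nat.lt_succ_iff.1 (Finset.mem_range.1 hu))]
  omega

lemma parentFun_zero (m : ℕ) (a : ∀ i : Fin m, Fin ((i : ℕ) + 1)) : parentFun m a 0 = 0 := by
  unfold parentFun
  split_ifs with h
  · have := (a ⟨0 - 1, h⟩).isLt
    simp only [Nat.zero_sub] at this ⊢
    omega
  · rfl

lemma parentFun_lt (m : ℕ) (a : ∀ i : Fin m, Fin ((i : ℕ) + 1)) (w : ℕ) (hw : 1 ≤ w) :
    parentFun m a w < w := by
  unfold parentFun
  split_ifs with h
  · have := (a ⟨w - 1, h⟩).isLt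
    simp only at this
    omega
  · omega

lemma sum_shape_ofParent (m : ℕ) (F : BinShape → ℝ) :
    ∑ a : (∀ i : Fin m, Fin ((i : ℕ) + 1)), F (LabTree.ofParent (parentFun m a) m).shape =
      (BinShape.grow^[m] F) .nil := by
  induction m generalizing F with
  | zero => simp [LabTree.ofParent, LabTree.shape]
  | succ m ih =>
    rw [Function.iterate_succ_apply, ← ih (BinShape.grow F),
      ← (Fin.snocEquiv (fun i : Fin (m + 1) => Fin ((i : ℕ) + 1))).sum_comp,
      Fintype.sum_prod_type_right]
    refine Finset.sum_congr rfl fun a _ => ?_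
    have hlt : ∀ w, 1 ≤ w → w ≤ m → parentFun m a w < w := fun w hw _ => parentFun_lt m a w hw
    rw [BinShape.grow, ← (LabTree.distinct_ofParent hlt).sum_attach (w := m + 1),
      LabTree.vertices_ofParent hlt, Finset.sum_range]
    refine Finset.sum_congr rfl fun v _ => ?_
    rw [LabTree.ofParent]
    congr 2
    have hlast : parentFun (m + 1)
        (Fin.snocEquiv (fun i : Fin (m + 1) => Fin ((i : ℕ) + 1)) (v, a)) (m + 1) = v := by
      simp only [parentFun, Nat.add_sub_cancel, Nat.lt_succ_self, dif_pos, Fin.snocEquiv,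
        Equiv.coe_fn_mk]
      exact congrArg Fin.val (Fin.snoc_last (α := fun i : Fin (m + 1) => Fin ((i : ℕ) + 1)) v a)
    have hinit : ∀ w, 1 ≤ w → w ≤ m → parentFun (m + 1)
        (Fin.snocEquiv (fun i : Fin (m + 1) => Fin ((i : ℕ) + 1)) (v, a)) w =
          parentFun m a w := by
      intro w h1 h2
      have hw : w - 1 < m := by omega
      have hw' : w - 1 < m + 1 := by omega
      simp only [parentFun, hw, hw', dif_pos, Fin.snocEquiv, Equiv.coe_fn_mk]
      exact congrArg Fin.val (Fin.snoc_castSucc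
        (α := fun i : Fin (m + 1) => Fin ((i : ℕ) + 1)) v a ⟨w - 1, hw⟩)
    rw [hlast, LabTree.ofParent_congr hinit]

lemma exp_le_add_exp_sq (y : ℝ) : Real.exp y ≤ y + Real.exp (y ^ 2) := by
  have h2 := Real.add_one_le_exp (y ^ 2)
  rcases le_or_gt y (-1) with h | h
  · have : Real.exp y ≤ 1 := Real.exp_le_one_iff.2 (by linarith)
    nlinarith
  rcases le_or_gt y 1 with h' | h'
  · have := (abs_le.1 (Real.abs_exp_sub_one_sub_id_le (abs_le.2 ⟨h.le, h'⟩))).2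
    linarith
  · have : Real.exp y ≤ Real.exp (y ^ 2) := Real.exp_le_exp.2 (by nlinarith)
    linarith

lemma one_add_exp_neg_le (l : ℝ) : 1 + Real.exp (-l) ≤ 2 * Real.exp (-l / 2 + l ^ 2 / 8) := by
  have h := Real.cosh_le_exp_half_sq (l / 2)
  rw [Real.cosh_eq] at h
  have e1 : Real.exp (-l / 2) * Real.exp (l / 2) = 1 := by
    rw [← Real.exp_add]
    simp [neg_div]
  have e2 : Real.exp (-l / 2) * Real.exp (-(l / 2)) = Real.exp (-l) := by
    rw [← Real.exp_add]
    congr 1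
    ring
  have e3 : (l / 2) ^ 2 / 2 = l ^ 2 / 8 := by ring
  rw [e3] at h
  rw [Real.exp_add]
  nlinarith [Real.exp_pos (-l / 2), mul_le_mul_of_nonneg_left h (Real.exp_pos (-l / 2)).le]

lemma sum_exp_window_le {k d : ℕ} {c l s : ℝ} (hd1 : 1 ≤ d) (hdk : d ≤ k) (hc : 0 ≤ c)
    (hs : 0 ≤ s) (hsl : s * (k + 1) = l - c * (k + 1) * l ^ 2)
    (hck : ((k : ℝ) - 1) ^ 2 ≤ (c * (k + 1) / 2 - 1 / 8) * (k + 1) ^ 2) :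
    ∑ j ∈ Finset.range d, Real.exp (s * (j + 1)) +
      ∑ j ∈ Finset.range d, Real.exp (-l) * Real.exp (s * (j + 1)) +
      ((k : ℝ) - d) * (Real.exp (-l) * Real.exp (s * (k + 1 + d))) ≤ k + d := by
  have hk : (1 : ℝ) ≤ k := by exact_mod_cast hd1.trans hdk
  have hd1' : (1 : ℝ) ≤ d := by exact_mod_cast hd1
  have hdk' : (d : ℝ) ≤ k := by exact_mod_cast hdk
  set η := Real.exp (-(c * (k + 1) * l ^ 2 / 2 - l ^ 2 / 8)) with hη
  set E := Real.exp ((((k : ℝ) - 1) * s) ^ 2) with hE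
  have hη0 : 0 < η := Real.exp_pos _
  have hexp : ∀ y : ℝ, |y| ≤ ((k : ℝ) - 1) * s → Real.exp y ≤ y + E := fun y hy =>
    (exp_le_add_exp_sq y).trans (by
      gcongr y + ?_
      exact Real.exp_le_exp.2 (sq_le_sq' (abs_le.1 hy).1 (abs_le.1 hy).2))
  have hpair : ∀ j ∈ Finset.range d, Real.exp (s * (j + 1)) + Real.exp (-l) * Real.exp (s * (j + 1))
      ≤ η * (2 * (s * (j + 1 - (k + 1) / 2) + E)) := by
    intro j hj
    have hjd : (j : ℝ) + 1 ≤ d := by exact_mod_cast Finset.mem_range.1 hj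
    have hj0 : (0 : ℝ) ≤ j := Nat.cast_nonneg j
    have h1 := one_add_exp_neg_le l
    have h2 := hexp (s * (j + 1 - (k + 1) / 2)) (abs_le.2 ⟨by nlinarith, by nlinarith⟩)
    calc Real.exp (s * (j + 1)) + Real.exp (-l) * Real.exp (s * (j + 1))
        = (1 + Real.exp (-l)) * Real.exp (s * (j + 1)) := by ring
      _ ≤ (2 * Real.exp (-l / 2 + l ^ 2 / 8)) * Real.exp (s * (j + 1)) := by gcongr
      _ = η * (2 * Real.exp (s * (j + 1 - (k + 1) / 2))) := by
        have : Real.exp (-l / 2 + l ^ 2 / 8) * Real.exp (s * (j + 1)) =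
            η * Real.exp (s * (j + 1 - (k + 1) / 2)) := by
          rw [hη, ← Real.exp_add, ← Real.exp_add]
          congr 1
          linear_combination (1 / 2 : ℝ) * hsl
        linear_combination 2 * this
      _ ≤ _ := by gcongr
  have hsingle : ((k : ℝ) - d) * (Real.exp (-l) * Real.exp (s * (k + 1 + d))) ≤
      ((k : ℝ) - d) * (η * (s * d + E)) := by
    rcases hdk.eq_or_lt with rfl | hlt
    · simp
    have hlt' : (d : ℝ) + 1 ≤ k := by exact_mod_cast hlt
    have h2 := hexp (s * d) (abs_le.2 ⟨by nlinarith, by nlinarith⟩)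
    have h3 : Real.exp (-l) * Real.exp (s * (k + 1 + d)) ≤ η * Real.exp (s * d) := by
      rw [hη, ← Real.exp_add, ← Real.exp_add, Real.exp_le_exp]
      have : 0 ≤ c * (k + 1) * l ^ 2 := by positivity
      nlinarith [sq_nonneg l]
    have : (0 : ℝ) ≤ k - d := by linarith
    exact mul_le_mul_of_nonneg_left
      (h3.trans (mul_le_mul_of_nonneg_left h2 hη0.le)) this
  have hsum : ∑ j ∈ Finset.range d, η * (2 * (s * ((j : ℝ) + 1 - (k + 1) / 2) + E)) =
      η * (s * (d * (d - k)) + 2 * d * E) := by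
    clear hpair hsingle hdk hdk' hd1 hd1'
    induction d with
    | zero => simp
    | succ d ih =>
      rw [Finset.sum_range_succ, ih]
      push_cast
      ring
  have hηE : η * E ≤ 1 := by
    rw [hη, hE, ← Real.exp_add, Real.exp_le_one_iff]
    have hsk : s * (k + 1) ≤ l := by
      have : 0 ≤ c * (k + 1) * l ^ 2 := by positivity
      linarith
    have h1 : (s * (k + 1)) ^ 2 ≤ l ^ 2 := by
      have : 0 ≤ s * (k + 1) := by positivity
      gcongr
    have hA : 0 ≤ c * (k + 1) / 2 - 1 / 8 := by
      by_contra hneg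
      push Not at hneg
      nlinarith [sq_nonneg ((k : ℝ) - 1), mul_neg_of_neg_of_pos hneg
        (show (0 : ℝ) < (k + 1) ^ 2 by positivity)]
    have h2 := mul_le_mul_of_nonneg_left h1 hA
    have h3 := mul_le_mul_of_nonneg_right hck (sq_nonneg s)
    nlinarith
  calc _ = ∑ j ∈ Finset.range d, (Real.exp (s * (j + 1)) + Real.exp (-l) * Real.exp (s * (j + 1)))
        + ((k : ℝ) - d) * (Real.exp (-l) * Real.exp (s * (k + 1 + d))) := by
        rw [Finset.sum_add_distrib]
    _ ≤ η * (s * (d * (d - k)) + 2 * d * E) + ((k : ℝ) - d) * (η * (s * d + E)) := by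
        rw [← hsum]
        exact add_le_add (Finset.sum_le_sum hpair) hsingle
    _ = (k + d) * (η * E) := by ring
    _ ≤ (k + d) * 1 := by gcongr
    _ = k + d := mul_one _

lemma convolution_mem_Icc {g B : ℕ → ℝ} (hg0 : ∀ i, 0 ≤ g i) (hg1 : ∀ i, g i ≤ 1)
    (hB0 : B 0 = 1)
    (hB : ∀ m : ℕ, ((m : ℝ) + 1) * B (m + 1) =
      ∑ i ∈ Finset.range (m + 1), g i * B i * B (m - i)) (m : ℕ) :
    0 ≤ B m ∧ B m ≤ 1 := by
  induction m using Nat.strong_induction_on with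
  | _ m ih =>
    cases m with
    | zero => simp [hB0]
    | succ m =>
      have hpos : (0 : ℝ) < m + 1 := by positivity
      have hi : ∀ i ∈ Finset.range (m + 1), (0 ≤ B i ∧ B i ≤ 1) ∧ 0 ≤ B (m - i) ∧ B (m - i) ≤ 1 :=
        fun i hi => ⟨ih i (Finset.mem_range.1 hi), ih (m - i) (by omega)⟩
      constructor
      · refine nonneg_of_mul_nonneg_right (a := (m : ℝ) + 1) ?_ hpos
        rw [hB]
        exact Finset.sum_nonneg fun i h =>
          mul_nonneg (mul_nonneg (hg0 i) (hi i h).1.1) (hi i h).2.1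
      · refine le_of_mul_le_mul_left (a := (m : ℝ) + 1) ?_ hpos
        rw [hB]
        calc _ ≤ ∑ i ∈ Finset.range (m + 1), (1 : ℝ) := Finset.sum_le_sum fun i h =>
              mul_le_one₀ (mul_le_one₀ (hg1 i) (hi i h).1.1 (hi i h).1.2) (hi i h).2.1
                (hi i h).2.2
          _ = _ := by simp

lemma sum_window_le {k m : ℕ} {c l s : ℝ} (hk : 1 ≤ k) (hkm : k ≤ m) (hc : 0 ≤ c)
    (hs : 0 ≤ s) (hsl : s * (k + 1) = l - c * (k + 1) * l ^ 2)
    (hck : ((k : ℝ) - 1) ^ 2 ≤ (c * (k + 1) / 2 - 1 / 8) * (k + 1) ^ 2) :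
    ∑ i ∈ Finset.range (m + 1), (if k ≤ i then (1 : ℝ) else Real.exp (s * (i + 1))) *
      (if k ≤ m - i then (1 : ℝ) else Real.exp (-l) * Real.exp (s * ((m - i : ℕ) + 1))) ≤
      m + 1 := by
  obtain ⟨d, e, hd1, hdk, hm, hcase⟩ : ∃ d e : ℕ, 1 ≤ d ∧ d ≤ k ∧ m + 1 = d + e + d ∧
      ((d = k) ∨ (e = k - d ∧ d < k)) := by
    rcases le_or_gt (2 * k) (m + 1) with h | h
    · exact ⟨k, m + 1 - 2 * k, hk, le_rfl, by omega, Or.inl rfl⟩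
    · exact ⟨m + 1 - k, 2 * k - (m + 1), by omega, by omega, by omega, Or.inr (by omega)⟩
  have hwin := sum_exp_window_le hd1 hdk hc hs hsl hck
  have hmr : (m : ℝ) + 1 = d + e + d := by exact_mod_cast hm
  rw [hm, Finset.sum_range_add, Finset.sum_range_add]
  have h1 : ∀ i ∈ Finset.range d, (if k ≤ i then (1 : ℝ) else Real.exp (s * (i + 1))) *
      (if k ≤ m - i then (1 : ℝ) else Real.exp (-l) * Real.exp (s * ((m - i : ℕ) + 1))) =
      Real.exp (s * (i + 1)) := by
    intro i hi
    have := Finset.mem_range.1 hi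
    rw [if_neg (by omega), if_pos (by omega), mul_one]
  have h3 : ∀ i ∈ Finset.range d,
      (if k ≤ d + e + i then (1 : ℝ) else Real.exp (s * ((d + e + i : ℕ) + 1))) *
      (if k ≤ m - (d + e + i) then (1 : ℝ) else
        Real.exp (-l) * Real.exp (s * ((m - (d + e + i) : ℕ) + 1))) =
      Real.exp (-l) * Real.exp (s * ((d - 1 - i : ℕ) + 1)) := by
    intro i hi
    have := Finset.mem_range.1 hi
    rw [if_pos (by omega), if_neg (by omega), one_mul,
      show m - (d + e + i) = d - 1 - i by omega]
  rw [Finset.sum_congr rfl h1, Finset.sum_congr rfl h3,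
    Finset.sum_range_reflect (fun j : ℕ => Real.exp (-l) * Real.exp (s * ((j : ℝ) + 1)))]
  rcases hcase with rfl | ⟨he, hlt⟩
  · have h2 : ∀ i ∈ Finset.range e,
        (if d ≤ d + i then (1 : ℝ) else Real.exp (s * ((d + i : ℕ) + 1))) *
        (if d ≤ m - (d + i) then (1 : ℝ) else
          Real.exp (-l) * Real.exp (s * ((m - (d + i) : ℕ) + 1))) = 1 := by
      intro i hi
      have := Finset.mem_range.1 hi
      rw [if_pos (by omega), if_pos (by omega), one_mul]
    rw [Finset.sum_congr rfl h2, Finset.sum_const, Finset.card_range, nsmul_eq_mul]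
    simp only [sub_self, zero_mul] at hwin
    linarith
  · have hkr : (k : ℝ) = d + e := by
      have : k = d + e := by omega
      exact_mod_cast this
    have h2 : ∀ i ∈ Finset.range e,
        (if k ≤ d + i then (1 : ℝ) else Real.exp (s * ((d + i : ℕ) + 1))) *
        (if k ≤ m - (d + i) then (1 : ℝ) else
          Real.exp (-l) * Real.exp (s * ((m - (d + i) : ℕ) + 1))) =
        Real.exp (-l) * Real.exp (s * (k + 1 + d)) := by
      intro i hi
      have := Finset.mem_range.1 hi
      rw [if_neg (by omega), if_neg (by omega), mul_left_comm, ← Real.exp_add]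
      congr 2
      have hmi : ((m - (d + i) : ℕ) : ℝ) = m - (d + i) := by
        rw [Nat.cast_sub (by omega)]
        push_cast
        ring
      rw [hmi, hkr]
      push_cast
      linear_combination s * hmr
    rw [Finset.sum_congr rfl h2, Finset.sum_const, Finset.card_range, nsmul_eq_mul]
    have : (k : ℝ) - d = e := by linarith
    rw [this] at hwin
    linarith

/-- Exponential decay of the coefficients of the convolution recursion satisfied by the moment
generating function of the number of nodes with large left subtree. -/
lemma exp_mul_convolution_le {k : ℕ} {c l s : ℝ} {B : ℕ → ℝ} (hk : 1 ≤ k) (hc : 0 ≤ c)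
    (hl : 0 ≤ l) (hsl : s * (k + 1) = l - c * (k + 1) * l ^ 2)
    (hck : ((k : ℝ) - 1) ^ 2 ≤ (c * (k + 1) / 2 - 1 / 8) * (k + 1) ^ 2)
    (hB0 : B 0 = 1)
    (hB : ∀ m : ℕ, ((m : ℝ) + 1) * B (m + 1) = ∑ i ∈ Finset.range (m + 1),
      (if k ≤ i then Real.exp (-l) else 1) * B i * B (m - i)) {m : ℕ} (hm : k ≤ m) :
    Real.exp (-l) * B m ≤ Real.exp (-(s * (m + 1))) := by
  have hx0 : 0 < Real.exp (-l) := Real.exp_pos _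
  have hx1 : Real.exp (-l) ≤ 1 := Real.exp_le_one_iff.2 (by linarith)
  have hB01 := convolution_mem_Icc (g := fun i => if k ≤ i then Real.exp (-l) else 1)
    (fun i => by split_ifs <;> positivity) (fun i => by split_ifs <;> linarith) hB0 hB
  rcases lt_or_ge s 0 with hs | hs
  · calc Real.exp (-l) * B m ≤ 1 := mul_le_one₀ hx1 (hB01 m).1 (hB01 m).2
      _ ≤ _ := Real.one_le_exp (by nlinarith [(Nat.cast_nonneg m : (0 : ℝ) ≤ m)])
  induction m using Nat.strong_induction_on with
  | _ m ih =>
    rcases hm.eq_or_lt with rfl | hlt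
    · calc Real.exp (-l) * B k ≤ Real.exp (-l) * 1 := by gcongr; exact (hB01 k).2
        _ ≤ _ := by
          rw [mul_one, Real.exp_le_exp]
          have : 0 ≤ c * (k + 1) * l ^ 2 := by positivity
          linarith
    obtain ⟨m, rfl⟩ : ∃ m', m = m' + 1 := ⟨m - 1, by omega⟩
    have hpos : (0 : ℝ) < m + 1 := by positivity
    refine le_of_mul_le_mul_left (a := (m : ℝ) + 1) ?_ hpos
    have hcancel : ∀ y : ℝ, Real.exp (-y) * Real.exp y = 1 := fun y => by
      rw [← Real.exp_add]
      simp
    have hp : ∀ i ≤ m, (if k ≤ i then Real.exp (-l) else 1) * B i ≤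
        Real.exp (-(s * (i + 1))) * (if k ≤ i then (1 : ℝ) else Real.exp (s * (i + 1))) := by
      intro i hi
      split_ifs with h
      · rw [mul_one]
        exact ih i (by omega) h
      · rw [hcancel, one_mul]
        exact (hB01 i).2
    have hq : ∀ i ≤ m, Real.exp (-l) * B i ≤ Real.exp (-(s * (i + 1))) *
        (if k ≤ i then (1 : ℝ) else Real.exp (-l) * Real.exp (s * (i + 1))) := by
      intro i hi
      split_ifs with h
      · rw [mul_one]
        exact ih i (by omega) h
      · rw [mul_left_comm, hcancel]
        gcongr
        exact (hB01 i).2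
    calc ((m : ℝ) + 1) * (Real.exp (-l) * B (m + 1))
        = ∑ i ∈ Finset.range (m + 1), ((if k ≤ i then Real.exp (-l) else 1) * B i) *
            (Real.exp (-l) * B (m - i)) := by
          rw [mul_left_comm, hB, Finset.mul_sum]
          exact Finset.sum_congr rfl fun i _ => by ring
      _ ≤ ∑ i ∈ Finset.range (m + 1),
            (Real.exp (-(s * (i + 1))) *
              (if k ≤ i then (1 : ℝ) else Real.exp (s * (i + 1)))) *
            (Real.exp (-(s * ((m - i : ℕ) + 1))) *
              (if k ≤ m - i then (1 : ℝ) else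
                Real.exp (-l) * Real.exp (s * ((m - i : ℕ) + 1)))) := by
          refine Finset.sum_le_sum fun i hi => ?_
          have hi' := Nat.lt_succ_iff.1 (Finset.mem_range.1 hi)
          refine mul_le_mul (hp i hi') (hq (m - i) (Nat.sub_le _ _)) ?_ ?_
          · exact mul_nonneg hx0.le (hB01 _).1
          · split_ifs <;> positivity
      _ = Real.exp (-(s * ((m + 1 : ℕ) + 1))) * ∑ i ∈ Finset.range (m + 1),
            (if k ≤ i then (1 : ℝ) else Real.exp (s * (i + 1))) *
            (if k ≤ m - i then (1 : ℝ) else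
              Real.exp (-l) * Real.exp (s * ((m - i : ℕ) + 1))) := by
          rw [Finset.mul_sum]
          refine Finset.sum_congr rfl fun i hi => ?_
          have hi' := Nat.lt_succ_iff.1 (Finset.mem_range.1 hi)
          have : Real.exp (-(s * ((m + 1 : ℕ) + 1))) =
              Real.exp (-(s * (i + 1))) * Real.exp (-(s * ((m - i : ℕ) + 1))) := by
            rw [← Real.exp_add, Nat.cast_sub hi']
            congr 1
            push_cast
            ring
          rw [this]
          ring
      _ ≤ Real.exp (-(s * ((m + 1 : ℕ) + 1))) * (m + 1) := by
          gcongr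
          exact sum_window_le hk (by omega) hc hs hsl hck
      _ = _ := mul_comm _ _

/-- Moment generating function bound for the number of vertices with at least `k` descendants. -/
lemma sum_exp_numDescGe_le {k m : ℕ} {c l s : ℝ} (hk : 1 ≤ k) (hkm : k ≤ m) (hc : 0 ≤ c)
    (hl : 0 ≤ l) (hsl : s * (k + 1) = l - c * (k + 1) * l ^ 2)
    (hck : ((k : ℝ) - 1) ^ 2 ≤ (c * (k + 1) / 2 - 1 / 8) * (k + 1) ^ 2) :
    ∑ a : (∀ i : Fin m, Fin ((i : ℕ) + 1)),
      Real.exp (-l * numDescGe (m + 1) k (parentFun m a)) ≤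
      m.factorial * Real.exp (-(s * (m + 1))) := by
  set g : ℕ → ℝ := fun i => if k ≤ i then Real.exp (-l) else 1 with hg
  set b : ℕ → ℝ := fun j => (BinShape.grow^[j] (BinShape.leftWeight g)) .nil with hb
  have hsum : ∑ a : (∀ i : Fin m, Fin ((i : ℕ) + 1)),
      Real.exp (-l * numDescGe (m + 1) k (parentFun m a)) = Real.exp (-l) * b m := by
    rw [hb]
    simp only
    rw [← sum_shape_ofParent, Finset.mul_sum]
    refine Finset.sum_congr rfl fun a _ => ?_
    rw [numDescGe_eq (parentFun_zero m a) (fun w hw _ => parentFun_lt m a w hw) hkm, hg,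
      BinShape.leftWeight_ite, ← Real.exp_nat_mul, ← Real.exp_add]
    congr 1
    push_cast
    ring
  have hfac : ∀ j : ℕ, (j.factorial : ℝ) ≠ 0 := fun j => by positivity
  have hB : ∀ j : ℕ, ((j : ℝ) + 1) * (b (j + 1) / (j + 1).factorial) =
      ∑ i ∈ Finset.range (j + 1), (if k ≤ i then Real.exp (-l) else 1) *
        (b i / i.factorial) * (b (j - i) / (j - i).factorial) := by
    intro j
    have h1 : b (j + 1) = _ := BinShape.grow_iterate_leftWeight_succ g j
    rw [Finset.Nat.sum_antidiagonal_eq_sum_range_succ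
      (fun p q => (j.choose p : ℝ) * (g p * (BinShape.grow^[p] (BinShape.leftWeight g)) .nil *
        (BinShape.grow^[q] (BinShape.leftWeight g)) .nil))] at h1
    rw [h1, Nat.factorial_succ, Finset.sum_div, Finset.mul_sum]
    refine Finset.sum_congr rfl fun i hi => ?_
    rw [Nat.cast_choose ℝ (Nat.lt_succ_iff.1 (Finset.mem_range.1 hi))]
    push_cast
    have : (j : ℝ) + 1 ≠ 0 := by positivity
    have h2 := hfac i
    have h3 := hfac (j - i)
    have h4 := hfac j
    simp only [hb, hg]
    field_simp
  have := exp_mul_convolution_le (B := fun j => b j / j.factorial) hk hc hl hsl hck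
    (by simp [hb, BinShape.leftWeight]) hB hkm
  rw [hsum]
  have hmf : (0 : ℝ) < m.factorial := by positivity
  calc Real.exp (-l) * b m = m.factorial * (Real.exp (-l) * (b m / m.factorial)) := by
        field_simp
    _ ≤ _ := by gcongr

lemma urrt_numDescGe_le {n k : ℕ} {c t θ : ℝ} (hk : 1 ≤ k) (hn : k + 1 ≤ n) (hc : 0 < c)
    (hck : ((k : ℝ) - 1) ^ 2 ≤ (c * (k + 1) / 2 - 1 / 8) * (k + 1) ^ 2) (ht : 0 ≤ t)
    (hθ : θ ≤ n / (k + 1) - t) :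
    urrt n {a | (numDescGe n k (parentFun (n - 1) a) : ℝ) ≤ θ} ≤
      ENNReal.ofReal (Real.exp (-(t ^ 2 / (4 * c * n)))) := by
  obtain ⟨m, rfl⟩ : ∃ m, n = m + 1 := ⟨n - 1, by omega⟩
  have hnpos : (0 : ℝ) < m + 1 := by positivity
  have hkpos : (0 : ℝ) < k + 1 := by positivity
  push_cast at hθ ⊢
  set l : ℝ := t / (2 * c * (m + 1)) with hl
  have hl0 : 0 ≤ l := by positivity
  have hmgf := sum_exp_numDescGe_le (c := c) (l := l) (s := l / (k + 1) - c * l ^ 2) hk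
    (by omega : k ≤ m) hc.le hl0 (by field_simp) hck
  set S : Set (∀ i : Fin m, Fin ((i : ℕ) + 1)) :=
    {a | (numDescGe (m + 1) k (parentFun m a) : ℝ) ≤ θ} with hS
  have hmarkov : (Fintype.card S : ℝ) ≤
      m.factorial * Real.exp (-(t ^ 2 / (4 * c * (m + 1)))) := by
    calc (Fintype.card S : ℝ) = ∑ a ∈ S.toFinset, (1 : ℝ) := by
          rw [Finset.sum_const, nsmul_eq_mul, mul_one, Set.toFinset_card]
      _ ≤ ∑ a ∈ S.toFinset, Real.exp (l * θ) *
            Real.exp (-l * numDescGe (m + 1) k (parentFun m a)) := by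
          refine Finset.sum_le_sum fun a ha => ?_
          have ha' : (numDescGe (m + 1) k (parentFun m a) : ℝ) ≤ θ := by
            simpa [hS] using ha
          rw [← Real.exp_add]
          exact Real.one_le_exp (by nlinarith)
      _ ≤ ∑ a, Real.exp (l * θ) * Real.exp (-l * numDescGe (m + 1) k (parentFun m a)) :=
          Finset.sum_le_sum_of_subset_of_nonneg (Finset.subset_univ _)
            fun _ _ _ => by positivity
      _ ≤ Real.exp (l * θ) *
          (m.factorial * Real.exp (-((l / (k + 1) - c * l ^ 2) * (m + 1)))) := by
          rw [← Finset.mul_sum]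
          gcongr
      _ = m.factorial * Real.exp (l * θ + -((l / (k + 1) - c * l ^ 2) * (m + 1))) := by
          rw [Real.exp_add]
          ring
      _ ≤ _ := by
          gcongr
          have h1 := mul_le_mul_of_nonneg_left hθ hl0
          have h2 : l * ((m + 1) / (k + 1) - t) + -((l / (k + 1) - c * l ^ 2) * (m + 1)) =
              -(t ^ 2 / (4 * c * (m + 1))) := by
            rw [hl]
            field_simp
            ring
          linarith
  have hcard : Fintype.card (∀ i : Fin m, Fin ((i : ℕ) + 1)) = m.factorial := by
    rw [Fintype.card_pi]
    simp only [Fintype.card_fin]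
    rw [Fin.prod_univ_eq_prod_range (fun i => i + 1), Finset.prod_range_add_one_eq_factorial]
  have hmeas : MeasurableSet S := S.toFinite.measurableSet
  change (PMF.uniformOfFintype (∀ i : Fin m, Fin ((i : ℕ) + 1))).toMeasure S ≤ _
  rw [PMF.toMeasure_uniformOfFintype_apply S hmeas, hcard]
  have hmf : (0 : ℝ) < m.factorial := by positivity
  rw [← ENNReal.ofReal_natCast, ← ENNReal.ofReal_natCast m.factorial,
    ← ENNReal.ofReal_div_of_pos hmf]
  apply ENNReal.ofReal_le_ofReal
  rw [div_le_iff₀' hmf]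
  exact hmarkov

/-- Assuming the upper-tail bound
`P{L_{i,n} ≥ E L_{i,n} + s} ≤ exp(-8s²(i+2)/(25(n + (i+1)(i+2)s/3)))` for each `i < k`, the
number `M_{k,n}` of vertices with at least `k` descendants in a uniform random recursive tree
on `n` vertices satisfies
`P{M_{k,n} ≤ (n+1)/(k+1) - 1 - t} ≤ k·exp(-8t²/(25k(n + (k+1)t/3)))` for all `t > 0`, and in
particular `P{M_{k,n} ≤ n/(3k)} ≤ k·exp(-(1/32)·n/k²)`. -/
theorem stmt19 (n k : ℕ) (hk : 1 ≤ k) (hn : k + 1 < n)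
    (hL : ∀ i < k, ∀ s : ℝ, 0 < s →
      urrt n {a | (∫ b, (numDescEq n i (parentFun (n - 1) b) : ℝ) ∂urrt n) + s ≤
          (numDescEq n i (parentFun (n - 1) a) : ℝ)} ≤
        ENNReal.ofReal
          (Real.exp (-8 * s ^ 2 * ((i : ℝ) + 2) /
            (25 * ((n : ℝ) + ((i : ℝ) + 1) * ((i : ℝ) + 2) * s / 3))))) :
    (∀ t : ℝ, 0 < t →
      urrt n {a | (numDescGe n k (parentFun (n - 1) a) : ℝ) ≤
          ((n : ℝ) + 1) / ((k : ℝ) + 1) - 1 - t} ≤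
        ENNReal.ofReal
          ((k : ℝ) * Real.exp (-8 * t ^ 2 / (25 * k * ((n : ℝ) + ((k : ℝ) + 1) * t / 3))))) ∧
    urrt n {a | (numDescGe n k (parentFun (n - 1) a) : ℝ) ≤ (n : ℝ) / (3 * k)} ≤
      ENNReal.ofReal ((k : ℝ) * Real.exp (-(1 / 32) * ((n : ℝ) / (k : ℝ) ^ 2))) := by
  have hk1 : (1 : ℝ) ≤ k := by exact_mod_cast hk
  have hnpos : (0 : ℝ) < n := by exact_mod_cast (by omega : 0 < n)
  obtain ⟨c, hc, hc2, hck, hfin⟩ : ∃ c : ℝ, 0 < c ∧ c ≤ 1 / 2 ∧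
      ((k : ℝ) - 1) ^ 2 ≤ (c * (k + 1) / 2 - 1 / 8) * (k + 1) ^ 2 ∧
      9 * c * ((k : ℝ) + 1) ^ 2 ≤ 8 * (2 * k - 1) ^ 2 := by
    rcases hk.eq_or_lt with rfl | h
    · exact ⟨1 / 8, by norm_num, by norm_num, by norm_num, by norm_num⟩
    · have h2 : (2 : ℝ) ≤ k := by exact_mod_cast h
      refine ⟨1 / 2, by norm_num, le_rfl, ?_, by nlinarith⟩
      nlinarith [mul_nonneg (sub_nonneg.2 h2) (sq_nonneg ((k : ℝ) + 1))]
  constructor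
  · intro t ht
    refine (urrt_numDescGe_le hk (by omega) hc hck ht.le ?_).trans
      (ENNReal.ofReal_le_ofReal ?_)
    · have : (1 : ℝ) / (k + 1) ≤ 1 := by
        rw [div_le_one (by positivity)]
        linarith
      rw [add_div]
      linarith
    · rw [← one_mul (Real.exp (-(t ^ 2 / (4 * c * n))))]
      gcongr
      rw [neg_mul, neg_div, neg_le_neg_iff, div_le_div_iff₀ (by positivity) (by positivity)]
      have h1 : 8 * (4 * c * n) ≤ 25 * k * (n + (k + 1) * t / 3) := by
        have h3 : 0 ≤ (k : ℝ) * ((k + 1) * t / 3) := by positivity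
        nlinarith
      nlinarith [mul_le_mul_of_nonneg_left h1 (sq_nonneg t)]
  · refine (urrt_numDescGe_le (t := n * (2 * k - 1) / (3 * k * (k + 1))) hk (by omega) hc hck
      ?_ ?_).trans (ENNReal.ofReal_le_ofReal ?_)
    · have : (0 : ℝ) ≤ 2 * k - 1 := by linarith
      positivity
    · apply le_of_eq
      field_simp
      ring
    · rw [← one_mul (Real.exp (-((n * (2 * k - 1) / (3 * k * (k + 1))) ^ 2 / (4 * c * n))))]
      gcongr
      rw [neg_mul, neg_le_neg_iff]
      have h1 : (n * (2 * k - 1) / (3 * k * (k + 1))) ^ 2 / (4 * c * n) =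
          (n : ℝ) / k ^ 2 * ((2 * k - 1) ^ 2 / (36 * c * (k + 1) ^ 2)) := by
        field_simp
        ring
      rw [h1, mul_comm]
      refine mul_le_mul_of_nonneg_left ?_ (by positivity)
      rw [div_le_div_iff₀ (by norm_num) (by positivity)]
      linarith
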